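/- arXiv:2010.08033 — 2 statements merged into one kernel-verified Lean document; each statement's English description precedes it below -/
import Mathlib

section
/- Let r > 0, ℓ ∈ ℝ and M ∈ ℝ. Let W and X be independent real-valued random variables, with X ≤ M almost surely, X bounded, and E[exp(-X/r)] ≤ 1. Suppose the law of W has a Lebesgue density g : ℝ → ℝ that is strictly positive everywhere, differentiable, and satisfies g'(a) ≤ g(a)/r for every a ≥ ℓ - M. Then P(W + X ≤ a) ≤ P(W ≤ a) for every a ≥ ℓ; equivalently, max(W + X, ℓ) first-order stochastically dominates max(W, ℓ). -/
open MeasureTheory ProbabilityTheory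

/-- If `deriv g ≤ g / r` on `[c, ∞)`, then `exp (-t / r) * g t` is nonincreasing there. -/
theorem antitoneOn_exp_mul_of_deriv_le {g : ℝ → ℝ} {r c : ℝ} (hg : Differentiable ℝ g)
    (hc : ∀ t, c ≤ t → deriv g t ≤ g t / r) :
    AntitoneOn (fun t => Real.exp (-t / r) * g t) (Set.Ici c) := by
  have hd : ∀ t, HasDerivAt (fun t => Real.exp (-t / r) * g t)
      (Real.exp (-t / r) * (-1 / r) * g t + Real.exp (-t / r) * deriv g t) t := fun t =>
    (((hasDerivAt_id t).neg.div_const r).exp).mul (hg t).hasDerivAt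
  refine antitoneOn_of_deriv_nonpos (convex_Ici c)
    (fun t _ => (hd t).continuousAt.continuousWithinAt)
    (fun t _ => (hd t).differentiableAt.differentiableWithinAt) fun t ht => ?_
  rw [interior_Ici] at ht
  rw [(hd t).deriv]
  have h : Real.exp (-t / r) * (deriv g t - g t / r) ≤ 0 :=
    mul_nonpos_of_nonneg_of_nonpos (Real.exp_pos _).le (sub_nonpos.2 (hc t ht.le))
  convert h using 1
  ring

/-- If `deriv g ≤ g / r` on `[c, ∞)`, then increments of a primitive of `g` are bounded by those
of the exponential with rate `1 / r` and the same derivative at `a`. -/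
theorem intervalIntegral_le_of_deriv_le {g : ℝ → ℝ} {r c a b : ℝ} (hr : 0 < r)
    (hg : Differentiable ℝ g) (hc : ∀ t, c ≤ t → deriv g t ≤ g t / r) (ha : c ≤ a) (hb : c ≤ b) :
    ∫ t in a..b, g t ≤ r * g a * (Real.exp ((b - a) / r) - 1) := by
  have hanti := antitoneOn_exp_mul_of_deriv_le hg hc
  have hexp : ∀ t, Real.exp ((t - a) / r) = Real.exp (t / r) * Real.exp (-a / r) := fun t => by
    rw [← Real.exp_add]; ring_nf
  have hinv : ∀ t, Real.exp (t / r) * Real.exp (-t / r) = 1 := fun t => by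
    rw [← Real.exp_add]; ring_nf; exact Real.exp_zero
  have hval : ∫ t in a..b, g a * Real.exp ((t - a) / r)
      = r * g a * (Real.exp ((b - a) / r) - 1) := by
    have hd : ∀ t, HasDerivAt (fun t => r * g a * Real.exp ((t - a) / r))
        (g a * Real.exp ((t - a) / r)) t := fun t => by
      refine (((((hasDerivAt_id t).sub_const a).div_const r).exp).const_mul (r * g a)).congr_deriv ?_
      simp only [id]
      field_simp
    rw [intervalIntegral.integral_eq_sub_of_hasDerivAt (fun t _ => hd t)
      (Continuous.intervalIntegrable (by fun_prop) _ _)]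
    simp
    ring
  rw [← hval]
  have hgc : Continuous g := hg.continuous
  rcases le_total a b with hab | hab
  · refine intervalIntegral.integral_mono_on hab (hgc.intervalIntegrable _ _)
      (Continuous.intervalIntegrable (by fun_prop) _ _) fun t ht => ?_
    have h := mul_le_mul_of_nonneg_left (hanti ha (ha.trans ht.1) ht.1) (Real.exp_pos (t / r)).le
    simp only [← mul_assoc, hinv, one_mul, ← hexp] at h
    linarith
  · rw [intervalIntegral.integral_symm b a, intervalIntegral.integral_symm b a, neg_le_neg_iff]
    refine intervalIntegral.integral_mono_on hab
      (Continuous.intervalIntegrable (by fun_prop) _ _) (hgc.intervalIntegrable _ _) fun t ht => ?_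
    have h := mul_le_mul_of_nonneg_left (hanti (hb.trans ht.1) ha ht.2) (Real.exp_pos (t / r)).le
    simp only [← mul_assoc, hinv, one_mul, ← hexp] at h
    linarith

/-- The distribution function of a sum of independent random variables is a convolution. -/
theorem ProbabilityTheory.IndepFun.measure_add_le {Ω : Type*} [MeasurableSpace Ω] {P : Measure Ω}
    [IsProbabilityMeasure P] {W X : Ω → ℝ} (hindep : IndepFun W X P) (hW : Measurable W)
    (hX : Measurable X) (a : ℝ) :
    P {ω | W ω + X ω ≤ a} = ∫⁻ ω, P.map W (Set.Iic (a - X ω)) ∂P := by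
  have : IsProbabilityMeasure (P.map W) := Measure.isProbabilityMeasure_map hW.aemeasurable
  have : IsProbabilityMeasure (P.map X) := Measure.isProbabilityMeasure_map hX.aemeasurable
  have hs : MeasurableSet {p : ℝ × ℝ | p.1 + p.2 ≤ a} :=
    measurableSet_le (measurable_fst.add measurable_snd) measurable_const
  have hF : Measurable fun x => P.map W (Set.Iic (a - x)) :=
    Antitone.measurable fun x y hxy =>
      measure_mono (Set.Iic_subset_Iic.2 (sub_le_sub_left hxy a))
  have hpre : {ω | W ω + X ω ≤ a} = (fun ω => (W ω, X ω)) ⁻¹' {p : ℝ × ℝ | p.1 + p.2 ≤ a} := rfl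
  rw [hpre, ← Measure.map_apply (hW.prodMk hX) hs,
    (indepFun_iff_map_prod_eq_prod_map_map hW.aemeasurable hX.aemeasurable).1 hindep,
    Measure.prod_apply_symm hs, ← lintegral_map hF hX]
  refine lintegral_congr fun x => congrArg _ (Set.ext fun w => ?_)
  simp [le_sub_iff_add_le]

/-- **Proposition 1 (limited liability version of the main theorem).** If `X ≤ M` a.s. is a
bounded gamble with Aumann–Serrano riskiness at most `r`, and the independent background
risk `W` has a strictly positive differentiable density `g` with `g' a ≤ g a / r` for every
`a ≥ ℓ - M`, then `P(W + X ≤ a) ≤ P(W ≤ a)` for every `a ≥ ℓ`; i.e. `max (W + X) ℓ`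
first-order stochastically dominates `max W ℓ`. -/
theorem accepting_is_dominant_limited_liability
    {Ω : Type*} [MeasurableSpace Ω] (P : Measure Ω) [IsProbabilityMeasure P]
    (r ℓ M : ℝ) (hr : 0 < r)
    (W X : Ω → ℝ) (hWmeas : Measurable W) (hXmeas : Measurable X)
    (hindep : IndepFun W X P)
    (hXbdd : ∃ C : ℝ, ∀ ω, |X ω| ≤ C)
    (hXleM : ∀ᵐ ω ∂P, X ω ≤ M)
    (hrisk : ∫ ω, Real.exp (-X ω / r) ∂P ≤ 1)
    (g : ℝ → ℝ) (hgpos : ∀ a, 0 < g a) (hgdiff : Differentiable ℝ g)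
    (hgtail : ∀ a, ℓ - M ≤ a → deriv g a ≤ g a / r)
    (hdens : Measure.map W P = volume.withDensity (fun a => ENNReal.ofReal (g a))) :
    ∀ a : ℝ, ℓ ≤ a → P {ω | W ω + X ω ≤ a} ≤ P {ω | W ω ≤ a} := by
  intro a ha
  obtain ⟨C, hC⟩ := hXbdd
  have hexp_int : Integrable (fun ω => Real.exp (-X ω / r)) P := by
    refine Integrable.of_bound (by fun_prop) (Real.exp (C / r)) (.of_forall fun ω => ?_)
    rw [Real.norm_eq_abs, Real.abs_exp]
    have := (abs_le.1 (hC ω)).1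
    gcongr
    linarith
  have hM : 0 ≤ M := by
    by_contra! hM
    have h : Real.exp (-M / r) ≤ ∫ ω, Real.exp (-X ω / r) ∂P := by
      calc Real.exp (-M / r) = ∫ _, Real.exp (-M / r) ∂P := by simp
        _ ≤ _ := integral_mono_ae (integrable_const _) hexp_int (by
          filter_upwards [hXleM] with ω hω
          gcongr)
    exact absurd (h.trans hrisk) (not_le.2 (Real.one_lt_exp_iff.2 (div_pos (by linarith) hr)))
  have : IsProbabilityMeasure (P.map W) := Measure.isProbabilityMeasure_map hWmeas.aemeasurable
  have hg_int : Integrable g := by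
    refine ⟨hgdiff.continuous.aestronglyMeasurable, ?_⟩
    rw [hasFiniteIntegral_iff_ofReal (.of_forall fun t => (hgpos t).le),
      ← setLIntegral_univ, ← withDensity_apply _ MeasurableSet.univ, ← hdens]
    exact measure_lt_top _ _
  have hcdf : ∀ b, P.map W (Set.Iic b) = ENNReal.ofReal (∫ t in Set.Iic b, g t) := fun b => by
    rw [hdens, withDensity_apply _ measurableSet_Iic,
      ofReal_integral_eq_lintegral_ofReal hg_int.integrableOn (.of_forall fun t => (hgpos t).le)]
  set h : Ω → ℝ := fun ω =>
    (∫ t in Set.Iic a, g t) + r * g a * (Real.exp (-X ω / r) - 1) with h_def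
  have hle : ∀ᵐ ω ∂P, ∫ t in Set.Iic (a - X ω), g t ≤ h ω := by
    filter_upwards [hXleM] with ω hω
    have hb := intervalIntegral_le_of_deriv_le (a := a) (b := a - X ω) hr hgdiff hgtail
      (by linarith) (by linarith)
    rw [← intervalIntegral.integral_Iic_sub_Iic hg_int.integrableOn hg_int.integrableOn,
      sub_sub_cancel_left] at hb
    simp only [h_def]
    linarith
  have hh_int : Integrable h P :=
    (integrable_const _).add ((hexp_int.sub (integrable_const _)).const_mul _)
  have hh_nonneg : 0 ≤ᵐ[P] h := by
    filter_upwards [hle] with ω hω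
    exact (integral_nonneg fun t => (hgpos t).le).trans hω
  have hh_le : ∫ ω, h ω ∂P ≤ ∫ t in Set.Iic a, g t := by
    have hsub : Integrable (fun ω => r * g a * (Real.exp (-X ω / r) - 1)) P :=
      (hexp_int.sub (integrable_const _)).const_mul _
    simp only [h_def]
    rw [integral_add (integrable_const _) hsub, integral_const_mul,
      integral_sub hexp_int (integrable_const _)]
    simp only [integral_const, probReal_univ, one_smul]
    have := mul_nonpos_of_nonneg_of_nonpos (mul_pos hr (hgpos a)).le (sub_nonpos.2 hrisk)
    linarith
  calc P {ω | W ω + X ω ≤ a}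
      = ∫⁻ ω, P.map W (Set.Iic (a - X ω)) ∂P := hindep.measure_add_le hWmeas hXmeas a
    _ ≤ ∫⁻ ω, ENNReal.ofReal (h ω) ∂P := lintegral_mono_ae (by
        filter_upwards [hle] with ω hω
        rw [hcdf]
        exact ENNReal.ofReal_le_ofReal hω)
    _ = ENNReal.ofReal (∫ ω, h ω ∂P) :=
        (ofReal_integral_eq_lintegral_ofReal hh_int hh_nonneg).symm
    _ ≤ ENNReal.ofReal (∫ t in Set.Iic a, g t) := ENNReal.ofReal_le_ofReal hh_le
    _ = P {ω | W ω ≤ a} := by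
        rw [← hcdf, Measure.map_apply hWmeas measurableSet_Iic]
        rfl
end

section
/- Let μ ∈ ℝ, σ > 0, ℓ ∈ ℝ, M ∈ ℝ and r > 0. Let W be a real random variable distributed according to the Gaussian distribution with mean μ and variance σ², and let X be a bounded real random variable independent of W with X ≤ M almost surely and E[exp(-X/r)] ≤ 1. If σ² ≥ r·(μ - ℓ + M), then P(W + X ≤ a) ≤ P(W ≤ a) for every a ≥ ℓ; that is, max(W + X, ℓ) first-order stochastically dominates max(W, ℓ). -/
open MeasureTheory ProbabilityTheory

lemma gaussianPDFReal_eq_mul_exp (m : ℝ) (v : NNReal) (a s : ℝ) :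
    gaussianPDFReal m v s =
      gaussianPDFReal m v a * Real.exp ((s - a) * ((2 * m - a - s) / (2 * v))) := by
  simp only [gaussianPDFReal]
  rw [mul_assoc _ (Real.exp _), ← Real.exp_add]
  congr 2
  ring

lemma gaussianPDFReal_le_exp_of_le {m r a s : ℝ} {v : NNReal} (hv : 0 < v) (hr : 0 < r)
    (has : a ≤ s) (ha : r * (m - a) ≤ v) :
    gaussianPDFReal m v s ≤ gaussianPDFReal m v a * Real.exp ((s - a) / r) := by
  have hv' : (0 : ℝ) < v := hv
  rw [gaussianPDFReal_eq_mul_exp m v a s, div_eq_mul_one_div (s - a) r]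
  refine mul_le_mul_of_nonneg_left (Real.exp_le_exp.2 ?_) (gaussianPDFReal_nonneg m v a)
  refine mul_le_mul_of_nonneg_left ?_ (sub_nonneg.2 has)
  rw [div_le_div_iff₀ (by positivity) hr]
  nlinarith

lemma exp_le_gaussianPDFReal_of_le {m r a s : ℝ} {v : NNReal} (hv : 0 < v) (hr : 0 < r)
    (hsa : s ≤ a) (hs : r * (m - s) ≤ v) :
    gaussianPDFReal m v a * Real.exp ((s - a) / r) ≤ gaussianPDFReal m v s := by
  have hv' : (0 : ℝ) < v := hv
  rw [gaussianPDFReal_eq_mul_exp m v a s, div_eq_mul_one_div (s - a) r]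
  refine mul_le_mul_of_nonneg_left (Real.exp_le_exp.2 ?_) (gaussianPDFReal_nonneg m v a)
  refine mul_le_mul_of_nonpos_left ?_ (sub_nonpos.2 hsa)
  rw [div_le_div_iff₀ (by positivity) hr]
  nlinarith

lemma gaussianReal_real_Iic_sub (m : ℝ) {v : NNReal} (hv : v ≠ 0) (a t : ℝ) :
    (gaussianReal m v).real (Set.Iic t) - (gaussianReal m v).real (Set.Iic a) =
      ∫ s in a..t, gaussianPDFReal m v s := by
  have key : ∀ b, (gaussianReal m v).real (Set.Iic b) =
      ∫ s in Set.Iic b, gaussianPDFReal m v s := fun b ↦ by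
    rw [measureReal_def, gaussianReal_apply_eq_integral m hv, ENNReal.toReal_ofReal]
    exact integral_nonneg fun s ↦ gaussianPDFReal_nonneg m v s
  rw [key, key]
  exact intervalIntegral.integral_Iic_sub_Iic (integrable_gaussianPDFReal m v).integrableOn
    (integrable_gaussianPDFReal m v).integrableOn

lemma integral_exp_sub_div {r : ℝ} (hr : r ≠ 0) (c a t : ℝ) :
    ∫ s in a..t, c * Real.exp ((s - a) / r) = r * c * (Real.exp ((t - a) / r) - 1) := by
  have hderiv : ∀ s ∈ Set.uIcc a t, HasDerivAt (fun s ↦ r * c * Real.exp ((s - a) / r))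
      (c * Real.exp ((s - a) / r)) s := fun s _ ↦ by
    have h := ((((hasDerivAt_id s).sub_const a).div_const r).exp).const_mul (r * c)
    refine h.congr_deriv ?_
    simp only [id]
    field_simp
  rw [intervalIntegral.integral_eq_sub_of_hasDerivAt hderiv
    (Continuous.intervalIntegrable (by fun_prop) _ _)]
  simp
  ring

/-- The Gaussian distribution function lies below the exponential curve tangent to it at `a`,
as long as the logarithmic derivative of the density stays below `1 / r`. -/
lemma gaussianReal_real_Iic_le_add_exp {m r a t : ℝ} {v : NNReal} (hv : 0 < v) (hr : 0 < r)
    (ha : r * (m - a) ≤ v) (ht : r * (m - t) ≤ v) :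
    (gaussianReal m v).real (Set.Iic t) ≤ (gaussianReal m v).real (Set.Iic a) +
      r * gaussianPDFReal m v a * (Real.exp ((t - a) / r) - 1) := by
  have hpdf : ∀ b c : ℝ, IntervalIntegrable (gaussianPDFReal m v) volume b c := fun b c ↦
    (integrable_gaussianPDFReal m v).intervalIntegrable
  have hexp : ∀ b c : ℝ, IntervalIntegrable
      (fun s ↦ gaussianPDFReal m v a * Real.exp ((s - a) / r)) volume b c := fun b c ↦
    Continuous.intervalIntegrable (by fun_prop) _ _
  rw [← sub_le_iff_le_add', gaussianReal_real_Iic_sub m hv.ne', ← integral_exp_sub_div hr.ne']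
  rcases le_total a t with hat | hta
  · exact intervalIntegral.integral_mono_on hat (hpdf _ _) (hexp _ _) fun s hs ↦
      gaussianPDFReal_le_exp_of_le hv hr hs.1 ha
  · rw [intervalIntegral.integral_symm t a, intervalIntegral.integral_symm t a, neg_le_neg_iff]
    refine intervalIntegral.integral_mono_on hta (hexp _ _) (hpdf _ _) fun s hs ↦
      exp_le_gaussianPDFReal_of_le hv hr hs.2 (le_trans ?_ ht)
    have := hs.1
    gcongr

lemma ProbabilityTheory.IndepFun.measure_add_le_eq_lintegral {Ω : Type*} [MeasurableSpace Ω]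
    {P : Measure Ω} [IsProbabilityMeasure P] {W X : Ω → ℝ} (hW : Measurable W)
    (hX : Measurable X) (h : IndepFun W X P) (a : ℝ) :
    P {ω | W ω + X ω ≤ a} = ∫⁻ ω, (P.map W) (Set.Iic (a - X ω)) ∂P := by
  have hS : MeasurableSet {p : ℝ × ℝ | p.1 + p.2 ≤ a} :=
    measurableSet_le (by fun_prop) (by fun_prop)
  have : IsProbabilityMeasure (P.map W) := Measure.isProbabilityMeasure_map hW.aemeasurable
  have : IsProbabilityMeasure (P.map X) := Measure.isProbabilityMeasure_map hX.aemeasurable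
  have hmap : P {ω | W ω + X ω ≤ a} = (P.map fun ω ↦ (W ω, X ω)) {p | p.1 + p.2 ≤ a} := by
    rw [Measure.map_apply (hW.prodMk hX) hS]
    rfl
  rw [hmap, (indepFun_iff_map_prod_eq_prod_map_map hW.aemeasurable hX.aemeasurable).1 h,
    Measure.prod_apply_symm hS, lintegral_map (measurable_measure_prodMk_right hS) hX]
  refine lintegral_congr fun ω ↦ congrArg _ ?_
  ext w
  simp [le_sub_iff_add_le]

/-- A random variable bounded above by a negative number has infinite riskiness. -/
lemma nonneg_of_integral_exp_neg_div_le_one {Ω : Type*} [MeasurableSpace Ω]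
    {P : Measure Ω} [IsProbabilityMeasure P] {X : Ω → ℝ} {M r : ℝ} (hr : 0 < r)
    (hexp_int : Integrable (fun ω ↦ Real.exp (-X ω / r)) P) (hXM : ∀ᵐ ω ∂P, X ω ≤ M)
    (h : ∫ ω, Real.exp (-X ω / r) ∂P ≤ 1) : 0 ≤ M := by
  have hle : Real.exp (-M / r) ≤ ∫ ω, Real.exp (-X ω / r) ∂P := by
    have hmono := integral_mono_ae (integrable_const (Real.exp (-M / r))) hexp_int
      (hXM.mono fun ω hω ↦ by dsimp only; gcongr)
    simpa using hmono
  have hdiv : -M / r ≤ 0 := Real.exp_le_one_iff.1 (hle.trans h)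
  rw [div_le_iff₀ hr] at hdiv
  linarith

/-- **Corollary 2 (Normal background risk and limited liability).** If the background risk
`W` is Gaussian with mean `m` and variance `σ²`, `X ≤ M` a.s. is an independent bounded
gamble with Aumann–Serrano riskiness at most `r` (i.e. `E[exp(-X/r)] ≤ 1`), and
`σ² ≥ r * (m - ℓ + M)`, then `P(W + X ≤ a) ≤ P(W ≤ a)` for every `a ≥ ℓ`; i.e. under
limited liability with bound `ℓ`, accepting `X` is dominant. -/
theorem accepting_is_dominant_gaussian_limited_liability
    {Ω : Type*} [MeasurableSpace Ω] (P : Measure Ω) [IsProbabilityMeasure P]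
    (m σ ℓ M r : ℝ) (hσ : 0 < σ) (hr : 0 < r)
    (W X : Ω → ℝ) (hWmeas : Measurable W) (hXmeas : Measurable X)
    (hindep : IndepFun W X P)
    (hgauss : Measure.map W P = gaussianReal m (Real.toNNReal (σ ^ 2)))
    (hXbdd : ∃ C : ℝ, ∀ ω, |X ω| ≤ C)
    (hXleM : ∀ᵐ ω ∂P, X ω ≤ M)
    (hrisk : ∫ ω, Real.exp (-X ω / r) ∂P ≤ 1)
    (hσ2 : r * (m - ℓ + M) ≤ σ ^ 2) :
    ∀ a : ℝ, ℓ ≤ a → P {ω | W ω + X ω ≤ a} ≤ P {ω | W ω ≤ a} := by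
  intro a ha
  obtain ⟨C, hC⟩ := hXbdd
  have hv : 0 < Real.toNNReal (σ ^ 2) := Real.toNNReal_pos.2 (by positivity)
  have hvσ : ((Real.toNNReal (σ ^ 2) : NNReal) : ℝ) = σ ^ 2 := Real.coe_toNNReal _ (by positivity)
  generalize Real.toNNReal (σ ^ 2) = v at hgauss hv hvσ
  have hexp_int : Integrable (fun ω ↦ Real.exp (-X ω / r)) P := by
    refine Integrable.of_bound (by fun_prop) (Real.exp (C / r)) (.of_forall fun ω ↦ ?_)
    rw [Real.norm_eq_abs, Real.abs_exp]
    have := (abs_le.1 (hC ω)).1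
    gcongr
    linarith
  have hM : 0 ≤ M := nonneg_of_integral_exp_neg_div_le_one hr hexp_int hXleM hrisk
  set F : ℝ → ℝ := fun t ↦ (gaussianReal m v).real (Set.Iic t) with hF
  set G : Ω → ℝ := fun ω ↦ F a + r * gaussianPDFReal m v a * (Real.exp (-X ω / r) - 1) with hG
  have hFG : ∀ᵐ ω ∂P, F (a - X ω) ≤ G ω := by
    filter_upwards [hXleM] with ω hω
    have h := gaussianReal_real_Iic_le_add_exp (m := m) (a := a) (t := a - X ω) hv hr
      (by rw [hvσ]; nlinarith) (by rw [hvσ]; nlinarith)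
    rwa [sub_sub_cancel_left] at h
  have hsub_int : Integrable
      (fun ω ↦ r * gaussianPDFReal m v a * (Real.exp (-X ω / r) - 1)) P :=
    (hexp_int.sub (integrable_const 1)).const_mul _
  have hGint : Integrable G P := (integrable_const _).add hsub_int
  have hGle : ∫ ω, G ω ∂P ≤ F a := by
    have h1 : ∫ ω, G ω ∂P =
        F a + r * gaussianPDFReal m v a * (∫ ω, Real.exp (-X ω / r) ∂P - 1) := by
      rw [hG, integral_add (integrable_const _) hsub_int, integral_const_mul,
        integral_sub hexp_int (integrable_const 1)]
      simp
    have := mul_nonneg hr.le (gaussianPDFReal_nonneg m v a)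
    rw [h1]
    nlinarith
  calc P {ω | W ω + X ω ≤ a}
      = ∫⁻ ω, ENNReal.ofReal (F (a - X ω)) ∂P := by
        rw [hindep.measure_add_le_eq_lintegral hWmeas hXmeas, hgauss]
        exact lintegral_congr fun ω ↦ (ofReal_measureReal (measure_ne_top _ _)).symm
    _ ≤ ∫⁻ ω, ENNReal.ofReal (G ω) ∂P :=
        lintegral_mono_ae (hFG.mono fun ω hω ↦ ENNReal.ofReal_le_ofReal hω)
    _ = ENNReal.ofReal (∫ ω, G ω ∂P) :=
        (ofReal_integral_eq_lintegral_ofReal hGint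
          (hFG.mono fun ω hω ↦ measureReal_nonneg.trans hω)).symm
    _ ≤ ENNReal.ofReal (F a) := ENNReal.ofReal_le_ofReal hGle
    _ = P {ω | W ω ≤ a} := by
        rw [hF, ofReal_measureReal, ← hgauss, Measure.map_apply hWmeas measurableSet_Iic]
        rfl
end
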